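/- Let d ≥ 1 and let μ be the radial measure on ℝ^d given by dμ(y) = μ₀(‖y‖₂) dy, where μ₀ : (0,∞) → [0,∞) is non-decreasing, not zero almost everywhere, and μ₀(t)·t^{d−1} is locally integrable on (0,∞). Then for every radial f ∈ L¹(ℝ^d, μ) and every λ > 0, λ · μ({x : M_μ f(x) > λ}) ≤ 4 · ‖f‖_{L¹(μ)}. In particular the constant 4 is uniform in the dimension d. -/

import Mathlib

open MeasureTheory Metric

/-- The centered Hardy–Littlewood maximal operator associated to a Borel measure `μ` on
`ℝ^d`, defined with closed Euclidean balls: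
`M_μ f (x) = sup { (1/μ(B̄(x,r))) ∫_{B̄(x,r)} |f| dμ : r > 0, μ(B̄(x,r)) > 0 }`. -/
noncomputable def centeredMaximal {d : ℕ} (μ : Measure (EuclideanSpace ℝ (Fin d)))
    (f : EuclideanSpace ℝ (Fin d) → ℝ) (x : EuclideanSpace ℝ (Fin d)) : ENNReal :=
  ⨆ (r : ℝ) (_ : 0 < r) (_ : 0 < μ (closedBall x r)),
    (μ (closedBall x r))⁻¹ * ∫⁻ y in closedBall x r, ENNReal.ofReal |f y| ∂μ

/-- A function on `ℝ^d` is radial if it only depends on the distance to the origin. -/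
def IsRadial {d : ℕ} (f : EuclideanSpace ℝ (Fin d) → ℝ) : Prop :=
  ∃ f₀ : ℝ → ℝ, ∀ x : EuclideanSpace ℝ (Fin d), x ≠ 0 → f x = f₀ ‖x‖

/-- The measure on `ℝ^d` with density `‖x‖₂^{-α}` with respect to Lebesgue measure. -/
noncomputable def muAlpha (d : ℕ) (α : ℝ) : Measure (EuclideanSpace ℝ (Fin d)) :=
  (volume : Measure (EuclideanSpace ℝ (Fin d))).withDensity
    (fun x => ENNReal.ofReal (‖x‖ ^ (-α)))

section WeakType

open Set Topology
open scoped ENNReal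

/-- Among three order-connected sets with a common point, one lies in the union of the others. -/
theorem exists_subset_biUnion_of_two_lt_card {α ι : Type*} [LinearOrder α] [DecidableEq ι]
    {A : ι → Set α} (hA : ∀ i, (A i).OrdConnected) {x : α} {s : Finset ι} (hx : ∀ i ∈ s, x ∈ A i)
    (hs : 2 < s.card) : ∃ i ∈ s, A i ⊆ ⋃ j ∈ s.erase i, A j := by
  have exists_max : ∀ (P : Set α), (∀ i ∈ s, ∀ j ∈ s, A i ∩ P ⊆ A j ∨ A j ∩ P ⊆ A i) →
      ∃ i ∈ s, ∀ j ∈ s, A j ∩ P ⊆ A i := by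
    intro P hP
    obtain ⟨i, hi, hmax⟩ := s.exists_maximalFor (fun i ↦ A i ∩ P)
      (Finset.card_pos.1 (by omega))
    refine ⟨i, hi, fun j hj ↦ ?_⟩
    rcases hP i hi j hj with h | h
    · exact (hmax hj (subset_inter h inter_subset_right)).trans inter_subset_left
    · exact h
  obtain ⟨l, hl, hl'⟩ := exists_max (Iic x) fun i hi j hj ↦ by
    by_contra! h
    obtain ⟨⟨a, ⟨ha, hax⟩, haj⟩, b, ⟨hb, hbx⟩, hbi⟩ := (not_subset.1 h.1), (not_subset.1 h.2)
    rcases le_total a b with hab | hab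
    · exact hbi ((hA i).out ha (hx i hi) ⟨hab, hbx⟩)
    · exact haj ((hA j).out hb (hx j hj) ⟨hab, hax⟩)
  obtain ⟨r, hr, hr'⟩ := exists_max (Ici x) fun i hi j hj ↦ by
    by_contra! h
    obtain ⟨⟨a, ⟨ha, hax⟩, haj⟩, b, ⟨hb, hbx⟩, hbi⟩ := (not_subset.1 h.1), (not_subset.1 h.2)
    rcases le_total a b with hab | hab
    · exact haj ((hA j).out (hx j hj) hb ⟨hax, hab⟩)
    · exact hbi ((hA i).out (hx i hi) ha ⟨hbx, hab⟩)
  obtain ⟨i, hi, hilr⟩ : ∃ i ∈ s, i ∉ ({l, r} : Finset ι) :=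
    Finset.exists_mem_notMem_of_card_lt_card (Finset.card_le_two.trans_lt hs)
  simp only [Finset.mem_insert, Finset.mem_singleton, not_or] at hilr
  refine ⟨i, hi, fun y hy ↦ ?_⟩
  simp only [mem_iUnion, Finset.mem_erase]
  rcases le_total y x with h | h
  · exact ⟨l, ⟨Ne.symm hilr.1, hl⟩, hl' i hi ⟨hy, h⟩⟩
  · exact ⟨r, ⟨Ne.symm hilr.2, hr⟩, hr' i hi ⟨hy, h⟩⟩

/-- A finite family of order-connected sets has a subfamily with the same union in which every
point is covered at most twice. -/
theorem exists_subcover_card_le_two {α ι : Type*} [LinearOrder α] [DecidableEq ι]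
    {A : ι → Set α} (hA : ∀ i, (A i).OrdConnected) (s : Finset ι) :
    ∃ t ⊆ s, (⋃ i ∈ s, A i) ⊆ ⋃ i ∈ t, A i ∧
      ∀ x, ∀ u ⊆ t, (∀ i ∈ u, x ∈ A i) → u.card ≤ 2 := by
  induction s using Finset.strongInduction with
  | H s ih =>
    by_cases h : ∀ x, ∀ u ⊆ s, (∀ i ∈ u, x ∈ A i) → u.card ≤ 2
    · exact ⟨s, subset_rfl, subset_rfl, h⟩
    push Not at h
    obtain ⟨x, u, hus, hx, hu⟩ := h
    obtain ⟨i, hi, hiu⟩ := exists_subset_biUnion_of_two_lt_card hA hx hu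
    obtain ⟨t, hts, hcov, ht⟩ := ih (s.erase i) (Finset.erase_ssubset (hus hi))
    refine ⟨t, hts.trans (Finset.erase_subset _ _), ?_, ht⟩
    refine subset_trans (iUnion₂_subset fun j hj ↦ ?_) hcov
    by_cases hji : j = i
    · subst hji
      exact hiu.trans (biUnion_subset_biUnion_left (Finset.erase_subset_erase _ hus))
    · exact subset_biUnion_of_mem (u := A) (Finset.mem_coe.2 (Finset.mem_erase.2 ⟨hji, hj⟩))

/-- The uncentered maximal inequality on the line, with constant `2`, for an arbitrary measure. -/
theorem measure_sUnion_ordConnected_le {ν : Measure ℝ} [ν.Regular] {g : ℝ → ℝ≥0∞}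
    (hg : AEMeasurable g ν) (c : ℝ≥0∞) {𝒰 : Set (Set ℝ)} (hopen : ∀ U ∈ 𝒰, IsOpen U)
    (hconn : ∀ U ∈ 𝒰, U.OrdConnected) (hc : ∀ U ∈ 𝒰, c * ν U ≤ ∫⁻ r in U, g r ∂ν) :
    c * ν (⋃₀ 𝒰) ≤ 2 * ∫⁻ r, g r ∂ν := by
  classical
  rw [(isOpen_sUnion hopen).measure_eq_iSup_isCompact]
  simp only [ENNReal.mul_iSup, iSup_le_iff]
  intro K hK hKc
  rw [sUnion_eq_iUnion] at hK
  obtain ⟨s, hs⟩ := hKc.elim_finite_subcover (fun U : 𝒰 ↦ (U : Set ℝ))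
    (fun U ↦ hopen U U.2) hK
  obtain ⟨t, -, hst, ht⟩ := exists_subcover_card_le_two (fun U : 𝒰 ↦ hconn U U.2) s
  calc c * ν K ≤ c * ∑ U ∈ t, ν U := by
        gcongr
        exact (measure_mono (hs.trans hst)).trans (measure_biUnion_finset_le _ _)
    _ ≤ ∑ U ∈ t, ∫⁻ r in U, g r ∂ν := by
        rw [Finset.mul_sum]
        exact Finset.sum_le_sum fun U _ ↦ hc U U.2
    _ = ∫⁻ r, ∑ U ∈ t, (U : Set ℝ).indicator g r ∂ν := by
        rw [lintegral_finsetSum' _ fun U hU ↦ hg.indicator (hopen _ U.2).measurableSet]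
        exact Finset.sum_congr rfl fun U _ ↦ (lintegral_indicator (hopen _ U.2).measurableSet _).symm
    _ ≤ ∫⁻ r, 2 * g r ∂ν := by
        refine lintegral_mono fun r ↦ ?_
        simp only [indicator_apply]
        rw [← Finset.sum_filter, Finset.sum_const, nsmul_eq_mul]
        gcongr
        exact_mod_cast ht r _ (Finset.filter_subset _ _) fun i hi ↦ (Finset.mem_filter.1 hi).2
    _ = 2 * ∫⁻ r, g r ∂ν := lintegral_const_mul' _ _ (by simp)

/-- An average bound over all open order-connected sets containing a point extends to all
order-connected sets containing it. -/
theorem setLIntegral_le_of_forall_isOpen_ordConnected {ν : Measure ℝ} [ν.OuterRegular]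
    {g : ℝ → ℝ≥0∞} {c : ℝ≥0∞} (hc : c ≠ ∞) {x : ℝ}
    (h : ∀ U : Set ℝ, IsOpen U → U.OrdConnected → x ∈ U → ∫⁻ r in U, g r ∂ν ≤ c * ν U)
    {S : Set ℝ} (hS : S.OrdConnected) (hx : x ∈ S) : ∫⁻ r in S, g r ∂ν ≤ c * ν S := by
  have key : ∀ V : Set ℝ, S ⊆ V → IsOpen V → ∫⁻ r in S, g r ∂ν ≤ c * ν V := by
    intro V hSV hV
    have hU : IsOpen (V.ordConnectedComponent x) := by
      refine isOpen_iff_mem_nhds.2 fun y hy ↦ ?_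
      rw [ordConnectedComponent_eq (mem_ordConnectedComponent.1 hy)]
      exact ordConnectedComponent_mem_nhds.2 (hV.mem_nhds (ordConnectedComponent_subset hy))
    calc ∫⁻ r in S, g r ∂ν ≤ ∫⁻ r in V.ordConnectedComponent x, g r ∂ν :=
          lintegral_mono_set (subset_ordConnectedComponent hx hSV)
      _ ≤ c * ν (V.ordConnectedComponent x) :=
          h _ hU inferInstance (self_mem_ordConnectedComponent.2 (hSV hx))
      _ ≤ c * ν V := by gcongr; exact ordConnectedComponent_subset
  rw [S.measure_eq_iInf_isOpen]
  rcases eq_or_ne c 0 with rfl | hc0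
  · simpa using key univ (subset_univ _) isOpen_univ
  · simpa only [ENNReal.mul_iInf_of_ne hc0 hc, le_iInf_iff] using key

variable {E : Type*} [NormedAddCommGroup E] [InnerProductSpace ℝ E] [FiniteDimensional ℝ E]
  [MeasurableSpace E] [BorelSpace E]

/-- Moving a ball away from the origin along a ray increases its measure. -/
theorem withDensity_closedBall_smul_le {m : ℝ → ℝ≥0∞} (hm : Monotone m) {a : ℝ} (ha : 0 ≤ a)
    (ha' : a ≤ 1) (x : E) (R : ℝ) :
    volume.withDensity (fun y : E ↦ m ‖y‖) (closedBall (a • x) R) ≤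
      volume.withDensity (fun y : E ↦ m ‖y‖) (closedBall x R) := by
  set μ := volume.withDensity (fun y : E ↦ m ‖y‖)
  set τ : E → E := fun y ↦ (a • x + x) - y with hτ
  have hmp : MeasurePreserving τ volume volume := Measure.measurePreserving_sub_left _ _
  have hBm : MeasurableSet (closedBall x R) := measurableSet_closedBall
  have hBam : MeasurableSet (closedBall (a • x) R) := measurableSet_closedBall
  have hmm : Measurable fun y : E ↦ m ‖y‖ := hm.measurable.comp measurable_norm
  have hpre : τ ⁻¹' (closedBall x R \ closedBall (a • x) R) =
      closedBall (a • x) R \ closedBall x R := by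
    ext y
    have h1 : a • x + x - y - x = -(y - a • x) := by abel
    have h2 : a • x + x - y - a • x = -(y - x) := by abel
    simp [hτ, dist_eq_norm, h1, h2, norm_neg, -neg_sub]
  have hnorm : ∀ y ∈ closedBall (a • x) R \ closedBall x R, ‖y‖ ≤ ‖τ y‖ := by
    intro y hy
    simp only [mem_sdiff, mem_closedBall, dist_eq_norm, not_le] at hy
    have h : ‖y - a • x‖ ^ 2 < ‖y - x‖ ^ 2 := by
      have := hy.1.trans_lt hy.2
      gcongr
    rw [norm_sub_sq_real, norm_sub_sq_real, norm_smul, inner_smul_right, Real.norm_eq_abs,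
      abs_of_nonneg ha] at h
    refine le_of_sq_le_sq ?_ (norm_nonneg _)
    have h3 : a • x + x = (a + 1) • x := by rw [add_smul, one_smul]
    rw [hτ]
    simp only
    rw [h3, norm_sub_sq_real, norm_smul, real_inner_smul_left, Real.norm_eq_abs,
      abs_of_nonneg (by linarith), real_inner_comm]
    by_contra! hlt
    nlinarith [norm_nonneg y, sq_nonneg ‖x‖]
  have hdiff : μ (closedBall (a • x) R \ closedBall x R) ≤
      μ (closedBall x R \ closedBall (a • x) R) := by
    rw [withDensity_apply _ (hBam.diff hBm), withDensity_apply _ (hBm.diff hBam),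
      ← hmp.setLIntegral_comp_preimage (hBm.diff hBam) hmm, hpre]
    exact setLIntegral_mono (hmm.comp hmp.measurable) fun y hy ↦ hm (hnorm y hy)
  calc μ (closedBall (a • x) R) = μ (closedBall (a • x) R ∩ closedBall x R) +
        μ (closedBall (a • x) R \ closedBall x R) := (measure_inter_add_sdiff _ hBm).symm
    _ ≤ μ (closedBall x R ∩ closedBall (a • x) R) +
        μ (closedBall x R \ closedBall (a • x) R) := by rw [inter_comm]; gcongr
    _ = μ (closedBall x R) := measure_inter_add_sdiff _ hBam

/-- A ball centred at `x ≠ 0` is contained in a set of at most twice its measure, each of whose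
radial slices is empty or an interval containing `‖x‖`. -/
theorem exists_closedBall_subset_radial_slices {m : ℝ → ℝ≥0∞} (hm : Monotone m) {x : E}
    (hx : x ≠ 0) {R : ℝ} (hR : 0 < R) :
    ∃ H : Set E, closedBall x R ⊆ H ∧ IsClosed H ∧
      volume.withDensity (fun y : E ↦ m ‖y‖) H ≤
        2 * volume.withDensity (fun y : E ↦ m ‖y‖) (closedBall x R) ∧
      ∀ θ : E, ‖θ‖ = 1 → {r : ℝ | 0 < r ∧ r • θ ∈ H} = ∅ ∨
        {r : ℝ | 0 < r ∧ r • θ ∈ H}.OrdConnected ∧ ‖x‖ ∈ {r : ℝ | 0 < r ∧ r • θ ∈ H} := by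
  set μ := volume.withDensity (fun y : E ↦ m ‖y‖)
  have hX : 0 < ‖x‖ := norm_pos_iff.2 hx
  have hunion : ∀ (Γ : Set E) (a : ℝ), 0 ≤ a → a ≤ 1 → Γ ⊆ closedBall (a • x) R →
      μ (closedBall x R ∪ Γ) ≤ 2 * μ (closedBall x R) := by
    intro Γ a ha ha' hΓ
    calc _ ≤ μ (closedBall x R) + μ Γ := measure_union_le _ _
      _ ≤ μ (closedBall x R) + μ (closedBall x R) := by
        exact add_le_add le_rfl
          ((measure_mono hΓ).trans (withDensity_closedBall_smul_le hm ha ha' x R))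
      _ = _ := (two_mul _).symm
  have hball : ∀ (r : ℝ) (θ : E), ‖θ‖ = 1 → (r • θ ∈ closedBall x R ↔
      r ^ 2 - 2 * r * inner ℝ x θ + ‖x‖ ^ 2 ≤ R ^ 2) := by
    intro r θ hθ
    rw [mem_closedBall, dist_eq_norm, ← sq_le_sq₀ (norm_nonneg _) hR.le, norm_sub_sq_real,
      norm_smul, hθ, mul_one, Real.norm_eq_abs, sq_abs, real_inner_smul_left, real_inner_comm,
      mul_assoc]
  have hconv : ∀ p C a b s : ℝ, a ≤ s → s ≤ b → a ^ 2 - 2 * a * p ≤ C → b ^ 2 - 2 * b * p ≤ C →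
      s ^ 2 - 2 * s * p ≤ C := by
    intro p C a b s has hsb ha hb
    rcases has.eq_or_lt with rfl | has
    · exact ha
    · have h1 : (b - a) * (s ^ 2 - 2 * s * p) ≤ (b - a) * C := by
        nlinarith [mul_le_mul_of_nonneg_left ha (sub_nonneg.2 hsb),
          mul_le_mul_of_nonneg_left hb (sub_nonneg.2 has.le),
          mul_nonneg (mul_nonneg (sub_nonneg.2 hsb) (sub_nonneg.2 has.le))
            (sub_nonneg.2 (has.le.trans hsb))]
      exact le_of_mul_le_mul_left h1 (by linarith)
  rcases le_or_gt ‖x‖ R with hxR | hxR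
  · refine ⟨closedBall x R ∪ closedBall 0 ‖x‖, subset_union_left,
      isClosed_closedBall.union isClosed_closedBall,
      hunion _ 0 le_rfl zero_le_one (by simpa using closedBall_subset_closedBall hxR), ?_⟩
    intro θ hθ
    have hmem : ∀ r : ℝ, 0 < r → (r • θ ∈ closedBall x R ∪ closedBall 0 ‖x‖ ↔
        r ^ 2 - 2 * r * inner ℝ x θ ≤ R ^ 2 - ‖x‖ ^ 2 ∨ r ≤ ‖x‖) := by
      intro r hr
      rw [mem_union, hball r θ hθ, mem_closedBall_zero_iff, norm_smul, hθ, mul_one,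
        Real.norm_eq_abs, abs_of_pos hr, le_sub_iff_add_le]
    refine .inr ⟨⟨fun a ha b hb s hs ↦ ?_⟩, hX, (hmem _ hX).2 (.inr le_rfl)⟩
    have hs0 : 0 < s := ha.1.trans_le hs.1
    refine ⟨hs0, (hmem s hs0).2 ?_⟩
    rcases (hmem b hb.1).1 hb.2 with h | h
    · refine .inl (hconv _ _ 0 b s hs0.le hs.2 ?_ h)
      nlinarith
    · exact .inr (hs.2.trans h)
  · obtain ⟨k, hk, hk2⟩ : ∃ k : ℝ, 0 ≤ k ∧ k ^ 2 = ‖x‖ ^ 2 - R ^ 2 :=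
      ⟨√(‖x‖ ^ 2 - R ^ 2), Real.sqrt_nonneg _, Real.sq_sqrt (by nlinarith)⟩
    have hkX : k ≤ ‖x‖ := le_of_sq_le_sq (by nlinarith [sq_nonneg R]) hX.le
    set Γ : Set E := {y | k ≤ ‖y‖ ∧ ‖y‖ ≤ ‖x‖ ∧ k * ‖y‖ ≤ inner ℝ x y}
    have hΓ : IsClosed Γ :=
      (isClosed_le continuous_const continuous_norm).inter
        ((isClosed_le continuous_norm continuous_const).inter
          (isClosed_le (f := fun y : E ↦ k * ‖y‖) (g := fun y ↦ inner ℝ x y)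
            (by fun_prop) (by fun_prop)))
    refine ⟨closedBall x R ∪ Γ, subset_union_left, isClosed_closedBall.union hΓ,
      hunion _ (k / ‖x‖) (by positivity) ((div_le_one hX).2 hkX) ?_, ?_⟩
    · rintro y ⟨hy1, hy2, hy3⟩
      rw [mem_closedBall, dist_eq_norm, ← sq_le_sq₀ (norm_nonneg _) hR.le, norm_sub_sq_real,
        norm_smul, inner_smul_right, Real.norm_eq_abs, abs_of_nonneg (by positivity),
        div_mul_cancel₀ _ hX.ne', real_inner_comm, div_mul_eq_mul_div]
      have h1 : k * (k * ‖y‖) / ‖x‖ ≤ k * inner ℝ x y / ‖x‖ := by gcongr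
      have h2 : ‖y‖ ^ 2 - 2 * (k * (k * ‖y‖) / ‖x‖) + k ^ 2 ≤ R ^ 2 := by
        have h3 : ‖y‖ ^ 2 - 2 * (k * (k * ‖y‖) / ‖x‖) + k ^ 2 - R ^ 2 =
            ((‖y‖ - ‖x‖) * (‖x‖ * ‖y‖ + ‖x‖ ^ 2 - 2 * k ^ 2)) / ‖x‖ := by
          field_simp
          linear_combination (-‖x‖) * hk2
        have h4 : 0 ≤ ‖x‖ * ‖y‖ + ‖x‖ ^ 2 - 2 * k ^ 2 := by nlinarith
        have h5 := div_nonpos_of_nonpos_of_nonneg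
          (mul_nonpos_of_nonpos_of_nonneg (sub_nonpos.2 hy2) h4) hX.le
        linarith
      linarith
    · intro θ hθ
      set p := inner ℝ x θ with hp
      have hmem : ∀ r : ℝ, 0 < r → (r • θ ∈ closedBall x R ∪ Γ ↔
          r ^ 2 - 2 * r * p ≤ -k ^ 2 ∨ k ≤ r ∧ r ≤ ‖x‖ ∧ k ≤ p) := by
        intro r hr
        rw [mem_union, hball r θ hθ, mem_ofPred_eq, norm_smul, hθ, mul_one,
          Real.norm_eq_abs, abs_of_pos hr, inner_smul_right, mul_comm k, mul_le_mul_iff_right₀ hr,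
          hk2, ← hp]
        refine or_congr ⟨fun h ↦ ?_, fun h ↦ ?_⟩ Iff.rfl <;> linarith
      rcases lt_or_ge p k with hpk | hpk
      · refine .inl (eq_empty_of_forall_notMem fun r hr ↦ ?_)
        rcases (hmem r hr.1).1 hr.2 with h | h
        · nlinarith [sq_nonneg (r - k), hr.1]
        · linarith [h.2.2]
      · refine .inr ⟨⟨fun a ha b hb s hs ↦ ?_⟩, hX, (hmem _ hX).2 (.inr ⟨hkX, le_rfl, hpk⟩)⟩
        have hs0 : 0 < s := ha.1.trans_le hs.1
        refine ⟨hs0, (hmem s hs0).2 ?_⟩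
        have hkk : k ^ 2 - 2 * k * p ≤ -k ^ 2 := by nlinarith
        rcases (hmem a ha.1).1 ha.2 with h | h <;> rcases (hmem b hb.1).1 hb.2 with h' | h'
        · exact .inl (hconv _ _ a b s hs.1 hs.2 h h')
        · rcases le_total s k with hsk | hsk
          · exact .inl (hconv _ _ a k s hs.1 hsk h hkk)
          · exact .inr ⟨hsk, hs.2.trans h'.2.1, hpk⟩
        · rcases le_total s ‖x‖ with hsx | hsx
          · exact .inr ⟨h.1.trans hs.1, hsx, hpk⟩
          · exact .inl (hconv _ _ k b s (hkX.trans hsx) hs.2 hkk h')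
        · exact .inr ⟨h.1.trans hs.1, hs.2.trans h'.2.1, hpk⟩

variable [Nontrivial E]

/-- Integration in polar coordinates. -/
theorem lintegral_eq_lintegral_toSphere {F : E → ℝ≥0∞} (hF : Measurable F) :
    ∫⁻ y, F y = ∫⁻ θ, ∫⁻ r in Ioi (0 : ℝ),
      ENNReal.ofReal (r ^ (Module.finrank ℝ E - 1)) * F (r • (θ : E))
        ∂volume ∂(volume : Measure E).toSphere := by
  have hmp := (volume : Measure E).measurePreserving_homeomorphUnitSphereProd
  calc ∫⁻ y, F y = ∫⁻ y : ({0}ᶜ : Set E), F y ∂(volume.comap ((↑) : ({0}ᶜ : Set E) → E)) := by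
        rw [lintegral_subtype_comap (measurableSet_singleton _).compl, restrict_compl_singleton]
    _ = ∫⁻ y : ({0}ᶜ : Set E), F ((homeomorphUnitSphereProd E y).2.1 •
          (homeomorphUnitSphereProd E y).1.1) ∂(volume.comap ((↑) : ({0}ᶜ : Set E) → E)) := by
        congr! 3 with y
        have : ‖(y : E)‖ ≠ 0 := norm_ne_zero_iff.2 y.2
        simp [smul_smul, this]
    _ = ∫⁻ p, F (p.2.1 • p.1.1) ∂((volume : Measure E).toSphere.prod
          (.volumeIoiPow (Module.finrank ℝ E - 1))) :=
        hmp.lintegral_comp (f := fun p ↦ F (p.2.1 • p.1.1)) (by fun_prop)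
    _ = _ := by
        rw [lintegral_prod _ (by fun_prop)]
        congr! 2 with θ
        rw [Measure.volumeIoiPow, lintegral_withDensity_eq_lintegral_mul _ (by fun_prop)
          (by fun_prop), ← lintegral_subtype_comap measurableSet_Ioi]
        rfl

/-- The radial part, on the half-line, of the measure on `E` with density `m ‖y‖`. -/
noncomputable def radialPart (n : ℕ) (m : ℝ → ℝ≥0∞) : Measure ℝ :=
  (volume.restrict (Ioi 0)).withDensity fun r ↦ m r * ENNReal.ofReal (r ^ (n - 1))

instance (n : ℕ) (m : ℝ → ℝ≥0∞) : SFinite (radialPart n m) :=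
  inferInstanceAs (SFinite (Measure.withDensity _ _))

theorem radialPart_Iic (n : ℕ) (m : ℝ → ℝ≥0∞) : radialPart n m (Iic 0) = 0 := by
  refine withDensity_absolutelyContinuous _ _ ?_
  rw [Measure.restrict_apply measurableSet_Iic]
  simp [Iic_inter_Ioi]

theorem isLocallyFiniteMeasure_radialPart (n : ℕ) {m : ℝ → ℝ≥0∞} (hm : Monotone m)
    (hm' : ∀ r, m r ≠ ∞) : IsLocallyFiniteMeasure (radialPart n m) := by
  refine ⟨fun x ↦ ⟨Iio (|x| + 1), Iio_mem_nhds (by linarith [le_abs_self x]), ?_⟩⟩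
  rw [radialPart, withDensity_apply _ measurableSet_Iio, Measure.restrict_restrict measurableSet_Iio]
  calc _ ≤ ∫⁻ _ in Iio (|x| + 1) ∩ Ioi 0,
        m (|x| + 1) * ENNReal.ofReal ((|x| + 1) ^ (n - 1)) := by
        refine setLIntegral_mono measurable_const fun r hr ↦ ?_
        have h0 : (0 : ℝ) < r := hr.2
        have h1 : r ≤ |x| + 1 := le_of_lt hr.1
        gcongr
        exact hm h1
    _ < ∞ := by
        rw [setLIntegral_const, inter_comm, Ioi_inter_Iio, Real.volume_Ioo]
        exact ENNReal.mul_lt_top (ENNReal.mul_lt_top (hm' _).lt_top ENNReal.ofReal_lt_top)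
          ENNReal.ofReal_lt_top

/-- Polar coordinates for a measure with radial density. -/
theorem measurePreserving_smul_radialPart {m : ℝ → ℝ≥0∞} (hm : Measurable m) :
    MeasurePreserving (fun p : sphere (0 : E) 1 × ℝ ↦ p.2 • (p.1 : E))
      ((volume : Measure E).toSphere.prod (radialPart (Module.finrank ℝ E) m))
      (volume.withDensity fun y ↦ m ‖y‖) := by
  have hT : Measurable fun p : sphere (0 : E) 1 × ℝ ↦ p.2 • (p.1 : E) := by fun_prop
  refine ⟨hT, Measure.ext fun s hs ↦ ?_⟩
  rw [Measure.map_apply hT hs, Measure.prod_apply (hT hs), withDensity_apply _ hs,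
    ← lintegral_indicator hs, lintegral_eq_lintegral_toSphere (by measurability)]
  refine lintegral_congr fun θ ↦ ?_
  have hs' : MeasurableSet ((fun r : ℝ ↦ r • (θ : E)) ⁻¹' s) :=
    (by fun_prop : Measurable fun r : ℝ ↦ r • (θ : E)) hs
  change radialPart _ m ((fun r : ℝ ↦ r • (θ : E)) ⁻¹' s) = _
  rw [radialPart, withDensity_apply _ hs', ← lintegral_indicator hs']
  refine setLIntegral_congr_fun measurableSet_Ioi fun r (hr : 0 < r) ↦ ?_
  have hnorm : ‖r • (θ : E)‖ = r := by simp [norm_smul, abs_of_pos hr]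
  by_cases h : r • (θ : E) ∈ s <;> simp [indicator, h, hnorm, mul_comm]

theorem ae_radialPart_pos (n : ℕ) (m : ℝ → ℝ≥0∞) : ∀ᵐ r ∂radialPart n m, 0 < r := by
  filter_upwards [measure_eq_zero_iff_ae_notMem.1 (radialPart_Iic n m)] with r hr
  exact not_le.1 hr

omit [FiniteDimensional ℝ E] [MeasurableSpace E] [BorelSpace E] [Nontrivial E] in
theorem ae_radialPart_smul_eq {m : ℝ → ℝ≥0∞} {F : E → ℝ≥0∞} {G : ℝ → ℝ≥0∞}
    (hFG : ∀ x ≠ 0, F x = G ‖x‖) (θ : sphere (0 : E) 1) :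
    (fun r : ℝ ↦ F (r • (θ : E))) =ᵐ[radialPart (Module.finrank ℝ E) m] G := by
  filter_upwards [ae_radialPart_pos _ m] with r hr
  have hθ : ‖(θ : E)‖ = 1 := by simp
  have h0 : r • (θ : E) ≠ 0 := by
    rw [← norm_ne_zero_iff, norm_smul, hθ]
    simpa using hr.ne'
  rw [hFG _ h0, norm_smul, hθ, mul_one, Real.norm_of_nonneg hr.le]

theorem aemeasurable_radialPart {m : ℝ → ℝ≥0∞} (hm : Measurable m) {F : E → ℝ≥0∞}
    {G : ℝ → ℝ≥0∞} (hFG : ∀ x ≠ 0, F x = G ‖x‖)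
    (hF : AEMeasurable F (volume.withDensity fun y ↦ m ‖y‖)) :
    AEMeasurable G (radialPart (Module.finrank ℝ E) m) := by
  have h := (hF.comp_quasiMeasurePreserving
    (measurePreserving_smul_radialPart hm).quasiMeasurePreserving).aestronglyMeasurable.prodMk_left
  have : NeZero (volume : Measure E).toSphere := ⟨Measure.toSphere_ne_zero _⟩
  obtain ⟨θ, hθ⟩ := h.exists
  exact hθ.aemeasurable.congr (ae_radialPart_smul_eq hFG θ)

/-- Integration in polar coordinates of a radial function over a set, slice by slice. -/
theorem setLIntegral_withDensity_norm {m : ℝ → ℝ≥0∞} (hm : Measurable m) {F : E → ℝ≥0∞}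
    {G : ℝ → ℝ≥0∞} (hFG : ∀ x ≠ 0, F x = G ‖x‖)
    (hF : AEMeasurable F (volume.withDensity fun y ↦ m ‖y‖))
    {H : Set E} (hH : MeasurableSet H) :
    ∫⁻ y in H, F y ∂(volume.withDensity fun y ↦ m ‖y‖) =
      ∫⁻ θ : sphere (0 : E) 1, ∫⁻ r in {r : ℝ | 0 < r ∧ r • (θ : E) ∈ H}, G r
        ∂(radialPart (Module.finrank ℝ E) m) ∂(volume : Measure E).toSphere := by
  have hmp := measurePreserving_smul_radialPart (E := E) hm
  have hFH := hF.indicator hH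
  rw [← lintegral_indicator hH, ← hmp.map_eq, lintegral_map' (by rwa [hmp.map_eq])
    hmp.measurable.aemeasurable,
    lintegral_prod (fun p : sphere (0 : E) 1 × ℝ ↦ H.indicator F (p.2 • (p.1 : E)))
      (hFH.comp_quasiMeasurePreserving hmp.quasiMeasurePreserving)]
  refine lintegral_congr fun θ ↦ ?_
  have hS : MeasurableSet {r : ℝ | 0 < r ∧ r • (θ : E) ∈ H} :=
    measurableSet_Ioi.inter ((by fun_prop : Measurable fun r : ℝ ↦ r • (θ : E)) hH)
  rw [← lintegral_indicator hS]
  refine lintegral_congr_ae ?_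
  filter_upwards [ae_radialPart_smul_eq hFG θ, ae_radialPart_pos _ m] with r hr hr0
  by_cases h : r • (θ : E) ∈ H <;> simp [indicator, h, hr0, hr]

theorem withDensity_norm_apply {m : ℝ → ℝ≥0∞} (hm : Measurable m) {H : Set E} (hH : MeasurableSet H) :
    volume.withDensity (fun y : E ↦ m ‖y‖) H =
      ∫⁻ θ : sphere (0 : E) 1, radialPart (Module.finrank ℝ E) m
        {r : ℝ | 0 < r ∧ r • (θ : E) ∈ H} ∂(volume : Measure E).toSphere := by
  simpa using setLIntegral_withDensity_norm hm (F := fun _ ↦ 1) (G := fun _ ↦ 1)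
    (fun _ _ ↦ rfl) aemeasurable_const hH

/-- The weak type inequality for radial functions and radially non-decreasing measures. -/
theorem withDensity_norm_weak_type {m : ℝ → ℝ≥0∞} (hm : Monotone m) (hm' : ∀ r, m r ≠ ∞)
    {F : E → ℝ≥0∞} {G : ℝ → ℝ≥0∞} (hFG : ∀ x ≠ 0, F x = G ‖x‖)
    (hF : AEMeasurable F (volume.withDensity fun y ↦ m ‖y‖)) {c : ℝ≥0∞} (hc : c ≠ ∞)
    {A : Set E} (hA : ∀ x ∈ A, ∃ R > 0,
      c * volume.withDensity (fun y ↦ m ‖y‖) (closedBall x R) <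
        ∫⁻ y in closedBall x R, F y ∂volume.withDensity fun y ↦ m ‖y‖) :
    c * volume.withDensity (fun y ↦ m ‖y‖) A ≤
      4 * ∫⁻ y, F y ∂volume.withDensity fun y ↦ m ‖y‖ := by
  set μ := volume.withDensity (fun y : E ↦ m ‖y‖) with hμ
  set ν := radialPart (Module.finrank ℝ E) m with hν
  have : IsLocallyFiniteMeasure ν := isLocallyFiniteMeasure_radialPart _ hm hm'
  have hmm := hm.measurable
  have hG : AEMeasurable G ν := aemeasurable_radialPart hmm hFG hF
  have hc2 : c / 2 ≠ ∞ := ENNReal.div_ne_top hc two_ne_zero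
  set 𝒰 : Set (Set ℝ) :=
    {U | IsOpen U ∧ U.OrdConnected ∧ c / 2 * ν U < ∫⁻ r in U, G r ∂ν} with h𝒰
  have hsub : A ⊆ {0} ∪ norm ⁻¹' ⋃₀ 𝒰 := by
    intro x hxA
    by_contra hx
    simp only [mem_union, mem_singleton_iff, mem_preimage, not_or] at hx
    obtain ⟨R, hR, hlt⟩ := hA x hxA
    obtain ⟨H, hBH, hHc, hμH, hH⟩ := exists_closedBall_subset_radial_slices hm hx.1 hR
    refine hlt.not_ge ?_
    calc ∫⁻ y in closedBall x R, F y ∂μ ≤ ∫⁻ y in H, F y ∂μ := lintegral_mono_set hBH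
      _ = ∫⁻ θ : sphere (0 : E) 1, ∫⁻ r in {r : ℝ | 0 < r ∧ r • (θ : E) ∈ H}, G r ∂ν
            ∂(volume : Measure E).toSphere :=
          setLIntegral_withDensity_norm hmm hFG hF hHc.measurableSet
      _ ≤ ∫⁻ θ : sphere (0 : E) 1, c / 2 * ν {r : ℝ | 0 < r ∧ r • (θ : E) ∈ H}
            ∂(volume : Measure E).toSphere := by
          refine lintegral_mono fun θ ↦ ?_
          rcases hH θ (by simp) with h | ⟨h, h'⟩
          · simp [h]
          · refine setLIntegral_le_of_forall_isOpen_ordConnected hc2 (fun U hU hU' hxU ↦ ?_) h h'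
            by_contra! hlt
            exact hx.2 ⟨U, ⟨hU, hU', hlt⟩, hxU⟩
      _ = c / 2 * μ H := by
          rw [lintegral_const_mul' _ _ hc2, hμ, withDensity_norm_apply hmm hHc.measurableSet]
      _ ≤ c / 2 * (2 * μ (closedBall x R)) := by gcongr
      _ = c * μ (closedBall x R) := by
          rw [← mul_assoc, ENNReal.div_mul_cancel two_ne_zero ENNReal.ofNat_ne_top]
  have hopen : IsOpen (⋃₀ 𝒰) := isOpen_sUnion fun U hU ↦ hU.1
  have hμ0 : μ {0} = 0 := withDensity_absolutelyContinuous _ _ (measure_singleton _)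
  have hweak := measure_sUnion_ordConnected_le hG (c / 2) (fun U (hU : U ∈ 𝒰) ↦ hU.1)
    (fun U hU ↦ hU.2.1) fun U hU ↦ hU.2.2.le
  have hslice : μ (norm ⁻¹' ⋃₀ 𝒰) ≤ ν (⋃₀ 𝒰) * (volume : Measure E).toSphere univ := by
    rw [hμ, withDensity_norm_apply hmm (hopen.measurableSet.preimage measurable_norm),
      ← lintegral_const]
    refine lintegral_mono fun θ ↦ measure_mono fun r hr ↦ ?_
    simpa [norm_smul, abs_of_pos hr.1] using hr.2
  have htotal : ∫⁻ y, F y ∂μ = (∫⁻ r, G r ∂ν) * (volume : Measure E).toSphere univ := by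
    rw [← setLIntegral_univ, setLIntegral_withDensity_norm hmm hFG hF .univ, ← lintegral_const]
    refine lintegral_congr fun θ ↦ ?_
    simp only [mem_univ, and_true]
    exact congrArg (lintegral · G) (Measure.restrict_eq_self_of_ae_mem (ae_radialPart_pos _ m))
  calc c * μ A ≤ c * (μ {0} + μ (norm ⁻¹' ⋃₀ 𝒰)) := by
        gcongr
        exact (measure_mono hsub).trans (measure_union_le _ _)
    _ ≤ c * (ν (⋃₀ 𝒰) * (volume : Measure E).toSphere univ) := by
        rw [hμ0, zero_add]; gcongr
    _ = 2 * (c / 2 * ν (⋃₀ 𝒰)) * (volume : Measure E).toSphere univ := by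
        rw [← mul_assoc 2, ENNReal.mul_div_cancel two_ne_zero ENNReal.ofNat_ne_top, mul_assoc]
    _ ≤ 2 * (2 * ∫⁻ r, G r ∂ν) * (volume : Measure E).toSphere univ := by gcongr
    _ = 4 * ∫⁻ y, F y ∂μ := by rw [htotal, ← mul_assoc, ← mul_assoc]; norm_num

end WeakType

/-- The Infante / Menárguez–Soria theorem: for a radial, radially non-decreasing measure
`dμ(y) = μ₀(‖y‖₂) dy` on `ℝ^d`, the centered maximal operator acting on radial functions
satisfies the weak type `(1,1)` inequality with the dimension-free constant `4`. -/
theorem radial_nondecreasing_weak_one_one (d : ℕ) (hd : 1 ≤ d)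
    (μ₀ : ℝ → ℝ) (hmeas : Measurable μ₀) (hmono : MonotoneOn μ₀ (Set.Ioi (0 : ℝ)))
    (hnonneg : ∀ t ∈ Set.Ioi (0 : ℝ), 0 ≤ μ₀ t)
    (hne : ¬ (∀ᵐ t ∂(volume.restrict (Set.Ioi (0 : ℝ))), μ₀ t = 0))
    (hloc : LocallyIntegrableOn (fun t => μ₀ t * t ^ (d - 1)) (Set.Ioi (0 : ℝ)))
    (μ : Measure (EuclideanSpace ℝ (Fin d)))
    (hμ : μ = volume.withDensity fun y => ENNReal.ofReal (μ₀ ‖y‖))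
    (f : EuclideanSpace ℝ (Fin d) → ℝ) (hrad : IsRadial f) (hint : Integrable f μ)
    (lam : ℝ) (hlam : 0 < lam) :
    ENNReal.ofReal lam * μ {x | ENNReal.ofReal lam < centeredMaximal μ f x} ≤
      4 * ∫⁻ x, ENNReal.ofReal |f x| ∂μ := by
  have : Nonempty (Fin d) := ⟨⟨0, hd⟩⟩
  set m : ℝ → ENNReal := fun t ↦ if 0 < t then ENNReal.ofReal (μ₀ t) else 0 with hm
  have hmono' : Monotone m := by
    intro s t hst
    by_cases hs : 0 < s
    · have ht : 0 < t := hs.trans_le hst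
      simpa only [hm, hs, ht, if_true] using ENNReal.ofReal_le_ofReal (hmono hs ht hst)
    · simp [hm, hs]
  have hfin : ∀ t, m t ≠ ⊤ := by
    intro t
    by_cases ht : 0 < t <;> simp [hm, ht]
  have hμm : μ = volume.withDensity fun y ↦ m ‖y‖ := by
    rw [hμ]
    refine withDensity_congr_ae ?_
    filter_upwards [measure_eq_zero_iff_ae_notMem.1
      (measure_singleton (μ := volume) (0 : EuclideanSpace ℝ (Fin d)))] with y hy
    have hy' : 0 < ‖y‖ := norm_pos_iff.2 hy
    simp [hm, hy']
  obtain ⟨f₀, hf₀⟩ := hrad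
  have hF : AEMeasurable (fun x ↦ ENNReal.ofReal |f x|) μ :=
    hint.aestronglyMeasurable.aemeasurable.abs.ennreal_ofReal
  rw [hμm] at hF ⊢
  refine withDensity_norm_weak_type hmono' hfin (G := fun t ↦ ENNReal.ofReal |f₀ t|)
    (fun x hx ↦ by rw [hf₀ x hx]) hF ENNReal.ofReal_ne_top fun x hx ↦ ?_
  simp only [Set.mem_ofPred_eq, centeredMaximal, lt_iSup_iff] at hx
  obtain ⟨r, hr, -, hlt⟩ := hx
  refine ⟨r, hr, lt_of_not_ge fun hle ↦ hlt.not_ge ?_⟩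
  rw [mul_comm, ← div_eq_mul_inv]
  exact ENNReal.div_le_of_le_mul hle
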